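/- For all natural numbers n, the Fishburn numbers ξ(11n+8), ξ(11n+9), and ξ(11n+10) are each divisible by 11. -/

import Mathlib

open Polynomial Finset

/-- The Fishburn numbers: ξ(n) is the coefficient of q^n in
∑_{j=0}^{n} ∏_{i=1}^{j} (1 - (1-q)^i). -/
noncomputable def fishburn (n : ℕ) : ℤ :=
  (∑ j ∈ Finset.range (n + 1), ∏ i ∈ Finset.range j, (1 - (1 - X) ^ (i + 1)) : Polynomial ℤ).coeff n

section QSeries

variable {R S : Type*} [CommRing R] [CommRing S]

/-- The `q`-Pochhammer polynomial `(qX; q)_n`. -/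
noncomputable def qPoch (q : R) (n : ℕ) : R[X] :=
  ∏ i ∈ range n, (1 - C (q ^ (i + 1)) * X)

/-- The partial sum `∑_{n < N} (qX; q)_n X ^ n`. -/
noncomputable def qPochSum (q : R) (N : ℕ) : R[X] :=
  ∑ n ∈ range N, qPoch q n * X ^ n

theorem qPoch_succ (q : R) (n : ℕ) :
    qPoch q (n + 1) = qPoch q n * (1 - C (q ^ (n + 1)) * X) :=
  prod_range_succ _ _

theorem qPoch_succ_eq_comp (q : R) (n : ℕ) :
    qPoch q (n + 1) = (1 - C q * X) * (qPoch q n).comp (C q * X) := by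
  rw [qPoch, qPoch, prod_range_succ', Polynomial.prod_comp, mul_comm]
  congr 1
  · simp
  · refine prod_congr rfl fun i _ => ?_
    simp [pow_succ, mul_assoc]

theorem qPochSum_succ (q : R) (N : ℕ) :
    qPochSum q (N + 1) = qPochSum q N + qPoch q N * X ^ N :=
  sum_range_succ _ _

/-- A truncated form of the functional equation `S(x) = 1 - q x² - q² x³ S(q x)` of
`S(x) = ∑ (x; q)_{n+1} x ^ n`. -/
theorem one_sub_X_mul_qPochSum (q : R) (N : ℕ) :
    (1 - X) * qPochSum q (N + 2) =
      1 - C q * X ^ 2 - C (q ^ 2) * (((1 - X) * qPochSum q N).comp (C q * X) * X ^ 3)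
        - qPoch q (N + 1) * X ^ (N + 2) := by
  induction N with
  | zero =>
    simp [qPochSum, qPoch, sum_range_succ]
    ring
  | succ N ih =>
    rw [qPochSum_succ q (N + 2), mul_add, ih, qPochSum_succ q N, qPoch_succ q (N + 1)]
    have h := qPoch_succ_eq_comp q N
    simp only [mul_comp, add_comp, sub_comp, one_comp, X_comp, X_pow_comp, C_pow] at h ⊢
    linear_combination (-C q ^ (N + 2) * X ^ (N + 3)) * h

/-- The low coefficients of `∑ (x; q)_{n+1} x ^ n` are multiples of pentagonal powers of `q`. -/
theorem exists_coeff_one_sub_X_mul_qPochSum (q : R) (m : ℕ) : ∀ N, m < N →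
    ∃ (c : ℤ) (e : ℕ), ((1 - X) * qPochSum q N).coeff m = c * q ^ e ∧
      (c = 0 ∨ 24 * e + 1 = (2 * m + 1) ^ 2) := by
  induction m using Nat.strong_induction_on with
  | _ m ih =>
    intro N hN
    rcases N with _ | _ | N
    · omega
    · obtain rfl : m = 0 := by omega
      exact ⟨1, 0, by simp [qPochSum, qPoch], by simp⟩
    · rw [one_sub_X_mul_qPochSum]
      rcases m with _ | _ | _ | m
      · exact ⟨1, 0, by simp, by simp⟩
      · refine ⟨0, 0, ?_, by simp⟩
        simp [coeff_mul_X_pow', coeff_one, coeff_C_mul, -map_pow]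
      · refine ⟨-1, 1, ?_, by simp⟩
        have : ¬ N + 2 ≤ 2 := by omega
        simp [coeff_mul_X_pow', coeff_one, coeff_C_mul, this, -map_pow]
      · obtain ⟨c, e, hc, he⟩ := ih m (by omega) N (by omega)
        refine ⟨-c, e + m + 2, ?_, ?_⟩
        · have h1 : ¬ N + 2 ≤ m + 3 := by omega
          rw [coeff_sub, coeff_sub, coeff_C_mul, coeff_mul_X_pow, comp_C_mul_X_coeff,
            hc, coeff_mul_X_pow', if_neg h1, coeff_sub, coeff_C_mul_X_pow, coeff_one]
          simp
          ring
        · rcases he with he | he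
          · simp [he]
          · right
            linarith

theorem qPoch_add (q : R) {L : ℕ} (hq : q ^ L = 1) (n : ℕ) :
    qPoch q (L + n) = qPoch q L * qPoch q n := by
  simp only [qPoch, prod_range_add, add_assoc, pow_add q L, hq, one_mul]

theorem qPoch_mul (q : R) {M : ℕ} (hq : q ^ M = 1) (k : ℕ) :
    qPoch q (M * k) = qPoch q M ^ k := by
  induction k with
  | zero => simp [qPoch]
  | succ k ih => rw [mul_add_one, add_comm, qPoch_add q hq, ih, pow_succ']

theorem qPochSum_add (q : R) {L : ℕ} (hq : q ^ L = 1) (N : ℕ) :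
    qPochSum q (L + N) = qPochSum q L + X ^ L * qPoch q L * qPochSum q N := by
  induction N with
  | zero => simp [qPochSum]
  | succ N ih =>
    rw [← add_assoc, qPochSum_succ, ih, qPochSum_succ, qPoch_add q hq]
    ring

theorem map_qPoch (f : R →+* S) (q : R) (n : ℕ) : (qPoch q n).map f = qPoch (f q) n := by
  simp [qPoch, Polynomial.map_prod]

theorem map_qPochSum (f : R →+* S) (q : R) (N : ℕ) :
    (qPochSum q N).map f = qPochSum (f q) N := by
  simp [qPochSum, Polynomial.map_sum, map_qPoch]

end QSeries

theorem pentagonal_mod_eleven {e m : ℕ} (h : 24 * e + 1 = (2 * m + 1) ^ 2) : e % 11 < 8 := by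
  have key : ∀ a b : ZMod 11, 24 * b + 1 = (2 * a + 1) ^ 2 → b.val < 8 := by decide
  rw [← ZMod.val_natCast]
  exact key m e (by exact_mod_cast congrArg (Nat.cast : ℕ → ZMod 11) h)

theorem iterate_derivative_pow_char_mul {R : Type*} [CommRing R] (p : ℕ) [CharP R p]
    (a f : R[X]) (k : ℕ) :
    derivative^[k] (a ^ p * f) = a ^ p * derivative^[k] f := by
  induction k generalizing f with
  | zero => rfl
  | succ k ih =>
    rw [Function.iterate_succ_apply, Function.iterate_succ_apply, ← ih]
    simp [derivative_mul, derivative_pow]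

theorem iterate_derivative_one_sub_X_pow {R : Type*} [CommRing R] (p : ℕ) [CharP R p]
    {k e : ℕ} (h : e % p < k) : derivative^[k] ((1 - X : R[X]) ^ e) = 0 := by
  rw [← Nat.div_add_mod e p, pow_add, mul_comm p, pow_mul, iterate_derivative_pow_char_mul,
    iterate_derivative_eq_zero, mul_zero]
  refine lt_of_le_of_lt ?_ h
  compute_degree

instance : Fact (Nat.Prime 11) := ⟨by norm_num⟩

theorem iterate_derivative_coeff_qPochSum {m N : ℕ} (h : m < N) :
    derivative^[8] ((qPochSum (1 - X : (ZMod 11)[X]) N).coeff m) = 0 := by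
  have key : ∀ m < N,
      derivative^[8] (((1 - X) * qPochSum (1 - X : (ZMod 11)[X]) N).coeff m) = 0 := by
    intro m hm
    obtain ⟨c, e, hc, he⟩ := exists_coeff_one_sub_X_mul_qPochSum (1 - X : (ZMod 11)[X]) m N hm
    rw [hc, ← zsmul_eq_mul, iterate_derivative_smul]
    rcases he with rfl | he
    · simp
    · rw [iterate_derivative_one_sub_X_pow 11 (pentagonal_mod_eleven he), smul_zero]
  induction m with
  | zero => simpa [sub_mul] using key 0 h
  | succ m ih =>
    have := key (m + 1) h
    rwa [sub_mul, one_mul, coeff_sub, coeff_X_mul, iterate_derivative_sub,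
      ih (by omega), sub_zero] at this

theorem X_pow_dvd_iterate_derivative_coeff_qPochSum (k m : ℕ) :
    (X ^ (11 ^ (k + 1)) : (ZMod 11)[X]) ∣
      derivative^[8] ((qPochSum (1 - X) (11 ^ (k + 1) * 11)).coeff m) := by
  obtain ⟨M, hM⟩ : ∃ M, M = 11 ^ (k + 1) := ⟨_, rfl⟩
  have hMk : 11 ^ k * 11 = M := hM ▸ (pow_succ _ _).symm
  rw [← hM]
  set q : (ZMod 11)[X] := 1 - X
  set I : Ideal (ZMod 11)[X] := Ideal.span {X ^ M}
  set π := Ideal.Quotient.mk I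
  have hq : π q ^ M = 1 := by
    rw [← map_pow, hM, sub_pow_char_pow, ← hM, one_pow, map_sub, map_one, sub_eq_self,
      Ideal.Quotient.eq_zero_iff_mem]
    exact Ideal.mem_span_singleton_self _
  have hqL : π q ^ (M * 11) = 1 := by rw [pow_mul, hq, one_pow]
  have h : (qPochSum q (M * 11)).map π = (qPochSum q (M * 11 + (m + 1)) -
      X ^ (M * 11) * qPoch q M ^ 11 * qPochSum q (m + 1)).map π := by
    simp only [Polynomial.map_sub, Polynomial.map_mul, Polynomial.map_pow, map_X, map_qPoch,
      map_qPochSum]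
    rw [qPochSum_add _ hqL, qPoch_mul _ hq, add_sub_cancel_right]
  have h' := congrArg (coeff · m) h
  simp only [coeff_map] at h'
  rw [Ideal.Quotient.eq, Ideal.mem_span_singleton] at h'
  obtain ⟨b, hb⟩ := h'
  have hb' := congrArg (derivative^[8]) (sub_eq_iff_eq_add.mp hb)
  have hXM : (X ^ M : (ZMod 11)[X]) * b = (X ^ (11 ^ k)) ^ 11 * b := by
    rw [← pow_mul, hMk]
  rw [iterate_map_add, hXM, iterate_derivative_pow_char_mul, ← pow_mul, hMk,
    coeff_sub, iterate_derivative_sub,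
    iterate_derivative_coeff_qPochSum (N := M * 11 + (m + 1)) (by omega)] at hb'
  have hz : derivative^[8] ((X ^ (M * 11) * qPoch q M ^ 11 * qPochSum q (m + 1)).coeff m) = 0 := by
    rw [pow_mul, ← mul_pow, coeff_mul, iterate_derivative_sum]
    refine sum_eq_zero fun x hx => ?_
    have hx' := mem_antidiagonal.mp hx
    rw [← map_frobenius_expand, coeff_map, coeff_expand (by norm_num), frobenius_def,
      iterate_derivative_pow_char_mul, iterate_derivative_coeff_qPochSum (by omega), mul_zero]
  rw [hz, sub_zero, add_zero] at hb'
  exact ⟨_, hb'⟩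

theorem X_pow_dvd_prod_one_sub {R : Type*} [CommRing R] (j : ℕ) :
    (X ^ j : R[X]) ∣ ∏ i ∈ range j, (1 - (1 - X) ^ (i + 1)) := by
  have h : ∀ i ∈ range j, (X : R[X]) ∣ 1 - (1 - X) ^ (i + 1) := fun i _ => by
    have h := sub_dvd_pow_sub_pow (1 : R[X]) (1 - X) (i + 1)
    rwa [sub_sub_cancel, one_pow] at h
  simpa using prod_dvd_prod_of_dvd _ _ h

theorem fishburn_cast {n L : ℕ} (h : n < L) (R : Type*) [CommRing R] :
    (fishburn n : R) = (eval 1 (qPochSum (1 - X : R[X]) L)).coeff n := by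
  obtain ⟨d, rfl⟩ := Nat.exists_eq_add_of_le (Nat.succ_le_of_lt h)
  have h1 : (fishburn n : R) =
      (∑ j ∈ range (n + 1), ∏ i ∈ range j, (1 - (1 - X) ^ (i + 1)) : R[X]).coeff n := by
    rw [fishburn, ← eq_intCast (Int.castRingHom R), ← coeff_map]
    simp [Polynomial.map_sum, Polynomial.map_prod]
  have h2 : eval 1 (qPochSum (1 - X : R[X]) (n.succ + d)) =
      ∑ j ∈ range (n + 1 + d), ∏ i ∈ range j, (1 - (1 - X) ^ (i + 1)) := by
    simp [qPochSum, qPoch, eval_finsetSum, eval_prod]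
  rw [h1, h2, sum_range_add _ (n + 1) d, coeff_add, finsetSum_coeff (range d),
    sum_eq_zero (s := range d), add_zero]
  intro j _
  exact X_pow_dvd_iff.mp (X_pow_dvd_prod_one_sub _) n (by omega)

theorem descFactorial_mul_fishburn (m : ℕ) :
    ((m + 8).descFactorial 8 : ZMod 11) * (fishburn (m + 8) : ZMod 11) = 0 := by
  have hlt : m + 8 < 11 ^ (m + 8 + 1) :=
    lt_trans (Nat.lt_succ_self _) (Nat.lt_pow_self (by norm_num))
  have hdvd : (X ^ (11 ^ (m + 8 + 1)) : (ZMod 11)[X]) ∣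
      derivative^[8] (eval 1 (qPochSum (1 - X) (11 ^ (m + 8 + 1) * 11))) := by
    rw [eval_eq_sum_range, iterate_derivative_sum]
    refine dvd_sum fun i _ => ?_
    rw [one_pow, mul_one]
    exact X_pow_dvd_iterate_derivative_coeff_qPochSum _ _
  have h := X_pow_dvd_iff.mp hdvd m (by omega)
  rwa [coeff_iterate_derivative, nsmul_eq_mul, ← fishburn_cast (by omega)] at h

theorem fishburn_mod11 : ∀ n : ℕ,
    (11 : ℤ) ∣ fishburn (11 * n + 8) ∧ (11 : ℤ) ∣ fishburn (11 * n + 9) ∧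
      (11 : ℤ) ∣ fishburn (11 * n + 10) := by
  intro n
  have h11 : (11 : ZMod 11) = 0 := rfl
  have key : ∀ j < 3, (11 : ℤ) ∣ fishburn (11 * n + j + 8) := by
    intro j hj
    refine (ZMod.intCast_zmod_eq_zero_iff_dvd _ 11).mp ?_
    refine (mul_eq_zero.mp (descFactorial_mul_fishburn (11 * n + j))).resolve_left ?_
    interval_cases j <;> simp [Nat.descFactorial, h11] <;> decide
  exact ⟨key 0 (by norm_num), key 1 (by norm_num), key 2 (by norm_num)⟩
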